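/- arXiv:cs/0210025 — 2 statements merged into one kernel-verified Lean document; each statement's English description precedes it below -/
import Mathlib

section
/- Let A be a finite alphabet and μ a probability measure on A^ℕ with the product σ-algebra. Let w, w' be finite words with μ(C(w)) > 0, μ(C(w')) > 0 that are causally equivalent (w ≈ w'). Then for every finite word u with μ(C(wu)) > 0, one also has μ(C(w'u)) > 0 and wu ≈ w'u; that is, causal equivalence is preserved under extension of histories by any word (the causal states are deterministic). -/
open MeasureTheory

/-- The cylinder set of a finite word `w`: all sequences beginning with `w`. -/
def cyl {A : Type*} (w : List A) : Set (ℕ → A) :=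
  {ω | ∀ i : Fin w.length, ω i = w.get i}

/-- Conditional probability `P(v | w) = μ(C(wv)) / μ(C(w))` of seeing the future word `v`
after the history `w`. -/
noncomputable def condP {A : Type*} [MeasurableSpace A]
    (μ : Measure (ℕ → A)) (w v : List A) : ENNReal :=
  μ (cyl (w ++ v)) / μ (cyl w)

/-- Chain rule: conditioning on `w ++ u` is conditioning on `w`, then renormalizing by `P(u | w)`. -/
theorem condP_append {A : Type*} [MeasurableSpace A] (μ : Measure (ℕ → A)) [IsFiniteMeasure μ]
    (w u v : List A) (hw : μ (cyl w) ≠ 0) :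
    condP μ (w ++ u) v = condP μ w (u ++ v) / condP μ w u := by
  simp only [condP, List.append_assoc, div_eq_mul_inv _ (μ (cyl w))]
  exact (ENNReal.mul_div_mul_right _ _ (ENNReal.inv_ne_zero.2 (measure_ne_top _ _))
    (ENNReal.inv_ne_top.2 hw)).symm

theorem condP_pos_iff {A : Type*} [MeasurableSpace A] (μ : Measure (ℕ → A)) [IsFiniteMeasure μ]
    (w v : List A) : 0 < condP μ w v ↔ 0 < μ (cyl (w ++ v)) := by
  simp [condP, pos_iff_ne_zero]

/-- Determinism of the causal states: causal equivalence of histories is preserved under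
extending both histories by any word `u` (as long as the extension of one has positive
probability, so does the other, and the extensions are again causally equivalent). -/
theorem causal_equivalence_deterministic
    {A : Type*} [Fintype A] [MeasurableSpace A] [MeasurableSingletonClass A]
    (μ : Measure (ℕ → A)) [IsProbabilityMeasure μ]
    (w w' : List A) (hw : 0 < μ (cyl w)) (hw' : 0 < μ (cyl w'))
    (heq : ∀ v : List A, condP μ w v = condP μ w' v) :
    ∀ u : List A, 0 < μ (cyl (w ++ u)) →
      0 < μ (cyl (w' ++ u)) ∧
      ∀ v : List A, condP μ (w ++ u) v = condP μ (w' ++ u) v := by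
  intro u hu
  refine ⟨?_, fun v => ?_⟩
  · rwa [← condP_pos_iff, ← heq, condP_pos_iff]
  · rw [condP_append μ w u v hw.ne', condP_append μ w' u v hw'.ne', heq, heq]
end

section
/- Let A be a finite alphabet and let x : ℕ → A be a sequence of minimal period p, i.e., x(n+p) = x(n) for all n and there is no q with 0 < q < p and x(n+q) = x(n) for all n. Let σ denote the left shift on A^ℕ and let μ = (1/p)·Σ_{j<p} δ_{σ^j x} be the law of the process obtained by choosing the phase uniformly at random. Then for every L ≥ p: the length-L words of positive μ-probability are exactly the p words (x(j), x(j+1), …, x(j+L−1)) for j = 0, …, p−1; these p words are pairwise distinct and pairwise causally inequivalent, each of probability 1/p. Hence the process has exactly p causal states at length L and its statistical complexity (the Shannon entropy of the causal-state partition) equals log p. -/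
open MeasureTheory

open Classical in
/-- The causal state (equivalence class under causal equivalence) of a length-`L` word
`w`, as a finset of length-`L` words of positive probability. -/
noncomputable def causalClass {A : Type*} [Fintype A] [MeasurableSpace A]
    (μ : Measure (ℕ → A)) (L : ℕ) (w : Fin L → A) : Finset (Fin L → A) :=
  Finset.univ.filter fun u => 0 < μ (cyl (List.ofFn u)) ∧
    ∀ v : List A, condP μ (List.ofFn w) v = condP μ (List.ofFn u) v

open Classical in
/-- The set of causal states at length `L`: the equivalence classes of causal equivalence
among the positive-probability length-`L` words. -/
noncomputable def causalCells {A : Type*} [Fintype A] [MeasurableSpace A]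
    (μ : Measure (ℕ → A)) (L : ℕ) : Finset (Finset (Fin L → A)) :=
  (Finset.univ.filter fun u : Fin L → A => 0 < μ (cyl (List.ofFn u))).image
    (causalClass μ L)

/-- The statistical complexity: the Shannon entropy of the causal-state partition at
length `L` (with the convention `0 log 0 = 0`). -/
noncomputable def statComplexity {A : Type*} [Fintype A] [MeasurableSpace A]
    (μ : Measure (ℕ → A)) (L : ℕ) : ℝ :=
  ∑ c ∈ causalCells μ L,
    Real.negMulLog (μ (⋃ w ∈ (c : Finset (Fin L → A)), cyl (List.ofFn w))).toReal

theorem mem_cyl_ofFn {A : Type*} {L : ℕ} (w : Fin L → A) (ω : ℕ → A) :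
    ω ∈ cyl (List.ofFn w) ↔ ∀ i : Fin L, ω i = w i := by
  constructor
  · intro h i
    simpa using h ⟨i, by simp⟩
  · intro h i
    simpa using h ⟨i, by simpa using i.2⟩

theorem mem_cyl_append {A : Type*} (w v : List A) (ω : ℕ → A) :
    ω ∈ cyl (w ++ v) ↔ ω ∈ cyl w ∧ (fun n => ω (w.length + n)) ∈ cyl v := by
  constructor
  · intro h
    refine ⟨fun i => ?_, fun i => ?_⟩
    · simpa using h ⟨i, by simp; omega⟩
    · simpa using h ⟨w.length + i, by simp⟩
  · rintro ⟨h₁, h₂⟩ ⟨i, hi⟩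
    rw [List.length_append] at hi
    by_cases hiw : i < w.length
    · simpa [List.getElem_append_left hiw] using h₁ ⟨i, hiw⟩
    · have hle : w.length ≤ i := not_lt.mp hiw
      simpa [List.getElem_append_right hle, Nat.add_sub_cancel' hle] using
        h₂ ⟨i - w.length, by omega⟩

theorem measurableSet_cyl {A : Type*} [MeasurableSpace A] [MeasurableSingletonClass A]
    (w : List A) : MeasurableSet (cyl w) := by
  have h : cyl w = ⋂ i : Fin w.length, (fun ω : ℕ → A => ω i) ⁻¹' {w.get i} := by
    ext ω
    simp [cyl]
  rw [h]
  exact MeasurableSet.iInter fun i => measurable_pi_apply _ (measurableSet_singleton _)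

theorem phase_le_of_window_eq {A : Type*} {x : ℕ → A} {p : ℕ}
    (hper : ∀ n, x (n + p) = x n)
    (hmin : ∀ q, 0 < q → q < p → ¬ ∀ n, x (n + q) = x n)
    {c j k : ℕ} (hj : j < p) (hk : k < p)
    (h : ∀ i < p, x (c + j + i) = x (c + k + i)) : k ≤ j := by
  by_contra! hjk
  have hx : Function.Periodic x p := hper
  have hmod : ∀ a i, x (a + i % p) = x (a + i) := fun a i => by
    rw [← hx.map_mod_nat (a + i % p), Nat.add_mod_mod, hx.map_mod_nat]
  have hall : ∀ i, x (c + j + i) = x (c + k + i) := fun i => by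
    rw [← hmod, ← hmod (c + k), h _ (Nat.mod_lt _ (by omega))]
  refine hmin (k - j) (by omega) (by omega) fun n => ?_
  obtain ⟨d, hd⟩ : ∃ d, (c + 1) * p = c + j + d := by
    refine Nat.exists_eq_add_of_le ?_
    nlinarith
  have hshift : ∀ m, x (m + (c + 1) * p) = x m := hx.nat_mul (c + 1)
  rw [← hshift (n + (k - j)), ← hshift n, hd]
  convert (hall (n + d)).symm using 2 <;> omega

/-- Two windows of length `p`, starting at `c + j` and `c + k`, of a sequence with minimal period
`p` agree only if they have the same phase. -/
theorem phase_eq_of_window_eq {A : Type*} {x : ℕ → A} {p : ℕ}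
    (hper : ∀ n, x (n + p) = x n)
    (hmin : ∀ q, 0 < q → q < p → ¬ ∀ n, x (n + q) = x n)
    {c j k : ℕ} (hj : j < p) (hk : k < p)
    (h : ∀ i < p, x (c + j + i) = x (c + k + i)) : j = k :=
  le_antisymm (phase_le_of_window_eq hper hmin hk hj fun i hi => (h i hi).symm)
    (phase_le_of_window_eq hper hmin hj hk h)

section UniformMixture

variable {Ω : Type*} [MeasurableSpace Ω] {p : ℕ} {y : ℕ → Ω} {S : Set Ω}

theorem uniform_dirac_apply (hS : MeasurableSet S) :
    ((p : ENNReal)⁻¹ • ∑ j ∈ Finset.range p, Measure.dirac (y j)) S =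
      (p : ENNReal)⁻¹ * ∑ j ∈ Finset.range p, S.indicator 1 (y j) := by
  simp [Measure.dirac_apply' _ hS]

theorem uniform_dirac_pos_iff (hS : MeasurableSet S) :
    0 < ((p : ENNReal)⁻¹ • ∑ j ∈ Finset.range p, Measure.dirac (y j)) S ↔
      ∃ j < p, y j ∈ S := by
  rw [uniform_dirac_apply hS, pos_iff_ne_zero]
  simp [Finset.sum_eq_zero_iff]

theorem uniform_dirac_eq_inv (hS : MeasurableSet S) {j : ℕ} (hj : j < p) (hjS : y j ∈ S)
    (huniq : ∀ k < p, y k ∈ S → k = j) :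
    ((p : ENNReal)⁻¹ • ∑ j ∈ Finset.range p, Measure.dirac (y j)) S = (p : ENNReal)⁻¹ := by
  rw [uniform_dirac_apply hS, Finset.sum_eq_single j]
  · simp [hjS]
  · intro k hk hkj
    exact Set.indicator_of_notMem (fun hkS => hkj (huniq k (Finset.mem_range.mp hk) hkS)) _
  · simp [hj]

end UniformMixture

/-- A process of minimal period `p` (the phase being chosen uniformly at random) has, at
every history length `L ≥ p`, exactly `p` positive-probability words — the `p` windows of
the periodic sequence — which are pairwise distinct and pairwise causally inequivalent,
each of probability `1/p`; hence there are exactly `p` causal states and the statistical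
complexity equals `log p`. -/
theorem periodic_process_statComplexity_eq_log_period
    {A : Type*} [Fintype A] [MeasurableSpace A] [MeasurableSingletonClass A]
    (x : ℕ → A) (p : ℕ) (hp : 0 < p)
    (hper : ∀ n, x (n + p) = x n)
    (hmin : ∀ q, 0 < q → q < p → ¬ ∀ n, x (n + q) = x n)
    (μ : Measure (ℕ → A))
    (hμ : μ = (p : ENNReal)⁻¹ •
      ∑ j ∈ Finset.range p, Measure.dirac (fun n => x (n + j))) :
    ∀ L : ℕ, p ≤ L →
      (∀ w : Fin L → A,
        (0 < μ (cyl (List.ofFn w)) ↔ ∃ j < p, w = fun i : Fin L => x (j + i.1))) ∧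
      (∀ j j' : ℕ, j < p → j' < p →
        (fun i : Fin L => x (j + i.1)) = (fun i : Fin L => x (j' + i.1)) → j = j') ∧
      (∀ j j' : ℕ, j < p → j' < p → j ≠ j' →
        ¬ ∀ v : List A,
          condP μ (List.ofFn fun i : Fin L => x (j + i.1)) v
            = condP μ (List.ofFn fun i : Fin L => x (j' + i.1)) v) ∧
      (∀ j : ℕ, j < p →
        μ (cyl (List.ofFn fun i : Fin L => x (j + i.1))) = 1 / p) ∧
      (causalCells μ L).card = p ∧
      statComplexity μ L = Real.log p := by
  classical
  intro L hL
  have hpos : ∀ w : List A, 0 < μ (cyl w) ↔ ∃ j < p, (fun n => x (n + j)) ∈ cyl w := fun w => by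
    rw [hμ]
    exact uniform_dirac_pos_iff (measurableSet_cyl w)
  have hword : ∀ w : Fin L → A,
      0 < μ (cyl (List.ofFn w)) ↔ ∃ j < p, w = fun i : Fin L => x (j + i.1) := fun w => by
    simp only [hpos, mem_cyl_ofFn, funext_iff, add_comm, eq_comm]
  have hinj : ∀ j j' : ℕ, j < p → j' < p →
      (fun i : Fin L => x (j + i.1)) = (fun i : Fin L => x (j' + i.1)) → j = j' :=
    fun j j' hj hj' h => phase_eq_of_window_eq (c := 0) hper hmin hj hj' fun i hi => by
      simpa using congrFun h ⟨i, by omega⟩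
  have hprob : ∀ j : ℕ, j < p →
      μ (cyl (List.ofFn fun i : Fin L => x (j + i.1))) = 1 / p := fun j hj => by
    rw [hμ, one_div]
    refine uniform_dirac_eq_inv (measurableSet_cyl _) hj ?_ fun k hk hkS => hinj k j hk hj ?_
    · simp [mem_cyl_ofFn, add_comm]
    · funext i
      simpa [add_comm] using (mem_cyl_ofFn _ _).1 hkS i
  have hineq : ∀ j j' : ℕ, j < p → j' < p → j ≠ j' →
      ¬ ∀ v : List A,
        condP μ (List.ofFn fun i : Fin L => x (j + i.1)) v
          = condP μ (List.ofFn fun i : Fin L => x (j' + i.1)) v := by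
    intro j j' hj hj' hne h
    have hv := h (List.ofFn fun i : Fin L => x (L + j + i.1))
    have hnum : 0 < μ (cyl ((List.ofFn fun i : Fin L => x (j + i.1)) ++
        List.ofFn fun i : Fin L => x (L + j + i.1))) := by
      refine (hpos _).2 ⟨j, hj, ?_⟩
      simp only [mem_cyl_append, mem_cyl_ofFn, List.length_ofFn]
      exact ⟨fun i => by rw [add_comm], fun i => by rw [add_right_comm]⟩
    have hcond : condP μ (List.ofFn fun i : Fin L => x (j + i.1))
        (List.ofFn fun i : Fin L => x (L + j + i.1)) ≠ 0 :=
      ENNReal.div_ne_zero.2 ⟨hnum.ne', by simp [hprob j hj, hp.ne']⟩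
    rw [hv] at hcond
    obtain ⟨k, hk, hmem⟩ := (hpos _).1 (pos_iff_ne_zero.2 (ENNReal.div_ne_zero.1 hcond).1)
    simp only [mem_cyl_append, mem_cyl_ofFn, List.length_ofFn] at hmem
    obtain rfl : k = j' := hinj k j' hk hj' (funext fun i => by simpa [add_comm] using hmem.1 i)
    refine hne (phase_eq_of_window_eq (c := L) hper hmin hj hk fun i hi => ?_)
    have hi' := hmem.2 ⟨i, by omega⟩
    rw [← hi', add_right_comm]
  have hclass : ∀ j < p, causalClass μ L (fun i : Fin L => x (j + i.1)) =
      {fun i : Fin L => x (j + i.1)} := fun j hj => by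
    ext u
    simp only [causalClass, Finset.mem_filter, Finset.mem_univ, true_and, Finset.mem_singleton]
    constructor
    · rintro ⟨hu, hequiv⟩
      obtain ⟨k, hk, rfl⟩ := (hword u).1 hu
      by_contra hne
      exact hineq j k hj hk (fun hjk => hne (by rw [hjk])) hequiv
    · rintro rfl
      exact ⟨(hword _).2 ⟨j, hj, rfl⟩, fun _ => rfl⟩
  have hcells : causalCells μ L =
      (Finset.range p).image fun j => {fun i : Fin L => x (j + i.1)} := by
    ext c
    simp only [causalCells, Finset.mem_image, Finset.mem_filter, Finset.mem_univ, true_and,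
      Finset.mem_range]
    constructor
    · rintro ⟨u, hu, rfl⟩
      obtain ⟨j, hj, rfl⟩ := (hword u).1 hu
      exact ⟨j, hj, (hclass j hj).symm⟩
    · rintro ⟨j, hj, rfl⟩
      exact ⟨_, (hword _).2 ⟨j, hj, rfl⟩, hclass j hj⟩
  have hcellInj : Set.InjOn (fun j => ({fun i : Fin L => x (j + i.1)} : Finset (Fin L → A)))
      (Finset.range p) := fun j hj k hk hjk =>
    hinj j k (by simpa using hj) (by simpa using hk) (Finset.singleton_injective hjk)
  refine ⟨hword, hinj, hineq, hprob, ?_, ?_⟩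
  · rw [hcells, Finset.card_image_of_injOn hcellInj, Finset.card_range]
  · have hp' : (p : ℝ) ≠ 0 := by exact_mod_cast hp.ne'
    rw [statComplexity, hcells, Finset.sum_image hcellInj]
    calc _ = ∑ j ∈ Finset.range p, Real.negMulLog (p : ℝ)⁻¹ :=
          Finset.sum_congr rfl fun j hj => by simp [hprob j (Finset.mem_range.1 hj)]
      _ = Real.log p := by
          simp [Real.negMulLog, Real.log_inv, hp']
end
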